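/- Let k ∈ ℤ and ι ∈ ℤ with ι ≥ 2. Then conv((0,0), (k,ι), (k + 2/5, ι)) ∩ ℤ² = {(0,0), (k,ι)} if and only if conv((0,0), (k,ι), (k + 1/3, ι)) ∩ ℤ² = {(0,0), (k,ι)}; that is, the polygon conv((0,0), (k,ι), (k + 2/5, ι)) is canonical if and only if the polygon conv((0,0), (k,ι), (k + 1/3, ι)) is canonical. -/

import Mathlib

/-- The set of lattice points of `ℚ²`. -/
def intPts : Set (ℚ × ℚ) := {p | ∃ m n : ℤ, p = ((m : ℚ), (n : ℚ))}

/-- A triangle with apex at the origin and a horizontal edge of length `c` at height `h`,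
described by inequalities. -/
lemma mem_convexHull_triangle_iff {k h c : ℚ} (hh : 0 < h) (hc : 0 < c) (x y : ℚ) :
    (x, y) ∈ convexHull ℚ ({((0 : ℚ), (0 : ℚ)), (k, h), (k + c, h)} : Set (ℚ × ℚ)) ↔
      y ≤ h ∧ 0 ≤ x * h - k * y ∧ x * h - k * y ≤ c * y := by
  rw [convexHull_insert (by simp), convexHull_pair]
  simp only [convexJoin_singleton_left, Set.mem_iUnion, exists_prop]
  constructor
  · rintro ⟨q, ⟨a, b, ha, hb, hab, rfl⟩, ⟨d, e, hd, he, hde, hq⟩⟩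
    obtain ⟨h1, h2⟩ := Prod.ext_iff.mp hq
    simp only [Prod.fst_add, Prod.snd_add, Prod.smul_fst, Prod.smul_snd, smul_eq_mul, mul_zero,
      zero_add] at h1 h2
    obtain rfl : a = 1 - b := by linarith
    have hy : y = e * h := by rw [← h2]; ring
    have hx : x = e * (k + b * c) := by rw [← h1]; ring
    have hr : x * h - k * y = e * h * c * b := by rw [hx, hy]; ring
    refine ⟨?_, ?_, ?_⟩
    · rw [hy]; nlinarith
    · rw [hr]; positivity
    · rw [hr, hy]
      have : 0 ≤ e * h * c * (1 - b) := by positivity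
      linarith
  · rintro ⟨hyh, h0, h1⟩
    have hy0 : 0 ≤ y := by
      by_contra hneg
      nlinarith
    rcases hy0.eq_or_lt with rfl | hy
    · have hx : x = 0 := by
        have : x * h = 0 := by linarith
        exact (mul_eq_zero.mp this).resolve_right hh.ne'
      subst hx
      exact ⟨(k, h), left_mem_segment ℚ _ _, left_mem_segment ℚ _ _⟩
    · have hcy : 0 < c * y := by positivity
      refine ⟨_, ⟨1 - (x * h - k * y) / (c * y), (x * h - k * y) / (c * y), ?_, by positivity,
        by ring, rfl⟩, ⟨1 - y / h, y / h, ?_, by positivity, by ring, ?_⟩⟩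
      · rw [sub_nonneg, div_le_one hcy]; exact h1
      · rw [sub_nonneg, div_le_one hh]; exact hyh
      · ext
        · simp only [Prod.fst_add, Prod.smul_fst, smul_eq_mul]
          field_simp
          ring
        · simp only [Prod.snd_add, Prod.smul_snd, smul_eq_mul]
          field_simp
          ring

/-- Canonicity of a triangle with top edge of length `a / b`, in terms of integers. -/
lemma convexHull_inter_intPts_eq_iff {k ι a b : ℤ} (hι : 0 < ι) (ha : 0 < a) (hb : 0 < b) :
    convexHull ℚ ({((0 : ℚ), (0 : ℚ)), ((k : ℚ), (ι : ℚ)),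
        ((k : ℚ) + (a : ℚ) / b, (ι : ℚ))} : Set (ℚ × ℚ)) ∩ intPts
      = {((0 : ℚ), (0 : ℚ)), ((k : ℚ), (ι : ℚ))} ↔
    ∀ m n : ℤ, n ≤ ι → 0 ≤ m * ι - k * n → b * (m * ι - k * n) ≤ a * n →
      (m = 0 ∧ n = 0) ∨ (m = k ∧ n = ι) := by
  have hιq : (0 : ℚ) < ι := by exact_mod_cast hι
  have haq : (0 : ℚ) < a := by exact_mod_cast ha
  have hbq : (0 : ℚ) < b := by exact_mod_cast hb
  have key (m n : ℤ) : ((m : ℚ), (n : ℚ)) ∈ convexHull ℚ ({((0 : ℚ), (0 : ℚ)),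
      ((k : ℚ), (ι : ℚ)), ((k : ℚ) + (a : ℚ) / b, (ι : ℚ))} : Set (ℚ × ℚ)) ↔
      n ≤ ι ∧ 0 ≤ m * ι - k * n ∧ b * (m * ι - k * n) ≤ a * n := by
    rw [mem_convexHull_triangle_iff hιq (div_pos haq hbq), div_mul_eq_mul_div, le_div_iff₀' hbq]
    norm_cast
  constructor
  · intro h m n h1 h2 h3
    have hmem := h.subset ⟨(key m n).mpr ⟨h1, h2, h3⟩, m, n, rfl⟩
    simpa only [Set.mem_insert_iff, Set.mem_singleton_iff, Prod.mk.injEq, Int.cast_eq_zero,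
      Int.cast_inj] using hmem
  · intro h
    apply Set.Subset.antisymm
    · rintro _ ⟨hp, m, n, rfl⟩
      obtain ⟨h1, h2, h3⟩ := (key m n).mp hp
      simpa only [Set.mem_insert_iff, Set.mem_singleton_iff, Prod.mk.injEq, Int.cast_eq_zero,
        Int.cast_inj] using h m n h1 h2 h3
    · rintro _ (rfl | rfl)
      · exact ⟨subset_convexHull ℚ _ (by simp), 0, 0, by simp⟩
      · exact ⟨subset_convexHull ℚ _ (by simp), k, ι, rfl⟩

/-- If the edge from the origin to `(k, ι)` has no lattice points in its relative interior, then
`k` and `ι` are coprime, and some lattice point of height in `[0, ι)` is at lattice distance one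
from that edge. -/
lemma exists_mul_sub_mul_eq_one {k ι : ℤ} (hι : 0 < ι)
    (h : ∀ m n : ℤ, n ≤ ι → m * ι = k * n → 0 < n → n = ι) :
    ∃ p a : ℤ, 0 ≤ a ∧ a < ι ∧ p * ι - k * a = 1 := by
  have hg : 0 < (Int.gcd k ι : ℤ) := by exact_mod_cast Int.gcd_pos_of_ne_zero_right k hι.ne'
  obtain ⟨k', hk⟩ := Int.gcd_dvd_left k ι
  obtain ⟨j, hj⟩ := Int.gcd_dvd_right k ι
  have hbez := Int.gcd_eq_gcd_ab k ι
  generalize (Int.gcd k ι : ℤ) = g at *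
  have hj0 : 0 < j := by
    by_contra hneg
    nlinarith
  have hjι : j = ι := h k' j (by nlinarith) (by linear_combination k' * hj - j * hk) hj0
  have hg1 : g = 1 := by
    rw [hjι] at hj
    exact mul_right_cancel₀ hι.ne' (by linarith)
  rw [hg1] at hbez
  refine ⟨Int.gcdB k ι - k * (-Int.gcdA k ι / ι), -Int.gcdA k ι % ι,
    Int.emod_nonneg _ hι.ne', Int.emod_lt_of_pos _ hι, ?_⟩
  have hdiv := Int.emod_add_mul_ediv (-Int.gcdA k ι) ι
  linear_combination -hbez - k * hdiv

/-- The rational polygon `conv((0,0), (k,ι), (k + 2/5, ι))` is canonical if and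
only if `conv((0,0), (k,ι), (k + 1/3, ι))` is canonical. -/
theorem canonical_two_fifth_iff_third (k ι : ℤ) (hι : 2 ≤ ι) :
    (convexHull ℚ ({((0 : ℚ), (0 : ℚ)), ((k : ℚ), (ι : ℚ)),
        ((k : ℚ) + 2 / 5, (ι : ℚ))} : Set (ℚ × ℚ)) ∩ intPts
      = {((0 : ℚ), (0 : ℚ)), ((k : ℚ), (ι : ℚ))}) ↔
    (convexHull ℚ ({((0 : ℚ), (0 : ℚ)), ((k : ℚ), (ι : ℚ)),
        ((k : ℚ) + 1 / 3, (ι : ℚ))} : Set (ℚ × ℚ)) ∩ intPts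
      = {((0 : ℚ), (0 : ℚ)), ((k : ℚ), (ι : ℚ))}) := by
  have h2 := convexHull_inter_intPts_eq_iff (k := k) (ι := ι) (a := 2) (b := 5)
    (by omega) (by norm_num) (by norm_num)
  have h1 := convexHull_inter_intPts_eq_iff (k := k) (ι := ι) (a := 1) (b := 3)
    (by omega) (by norm_num) (by norm_num)
  push_cast at h1 h2
  rw [h1, h2]
  refine ⟨fun h m n hn hr hle => h m n hn hr (by omega), fun h m n hn hr hle => ?_⟩
  rcases hr.eq_or_lt with hr0 | hr1
  · exact h m n hn hr (by omega)
  exfalso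
  obtain ⟨p, a, ha0, haι, hpa⟩ := exists_mul_sub_mul_eq_one (k := k) (ι := ι) (by omega)
    fun m n hn he hpos => by
      have := h m n hn (by omega) (by omega)
      omega
  have ha3 : a < 3 := by
    by_contra hge
    have := h p a haι.le (by omega) (by omega)
    omega
  have ha1 : 0 < a := by
    refine ha0.lt_of_ne fun h0 => ?_
    subst h0
    have := Int.eq_one_or_neg_one_of_mul_eq_one' (show p * ι = 1 by linarith)
    omega
  have hdvd : ι ∣ n - (m * ι - k * n) * a :=
    ⟨n * p - a * m, by linear_combination -n * hpa⟩
  have hpos : 0 < n - (m * ι - k * n) * a := by nlinarith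
  have hle' := Int.le_of_dvd hpos hdvd
  nlinarith
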